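/- Let w = w_t be the work function at time t ≥ 1 of a 3-server instance on the circle of circumference 2Δ with last request r = r_t, let u be a circle point, and let (x,y,z) ∈ P. If w({u,x,ȳ}) resolves from u, w({u,y,z̄}) resolves from z̄, and w({u,z,x̄}) resolves from z, then there exists a triple (x',y',z') ∈ P such that Φ*(w, u, x, y, z) ≥ Φ*(w, r, x', y', z'). -/

import Mathlib

open Finset

/-- Minimum-matching (Wasserstein) distance between two `k`-point configurations,
represented as `k`-tuples of points. -/
noncomputable def confDist {Ω : Type*} [MetricSpace Ω] {k : ℕ} (X Y : Fin k → Ω) : ℝ :=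
  ⨅ σ : Equiv.Perm (Fin k), ∑ i, dist (X i) (Y (σ i))

/-- The work function at time `t` of the `k`-server instance with initial configuration
`X₀` and requests `r 1, r 2, …` (the value `r 0` is unused): the least cost of serving
the first `t` requests and then moving to the configuration `X`. -/
noncomputable def workFn {Ω : Type*} [MetricSpace Ω] (k : ℕ) (X₀ : Fin k → Ω)
    (r : ℕ → Ω) (t : ℕ) (X : Fin k → Ω) : ℝ :=
  sInf { c : ℝ | ∃ Y : ℕ → Fin k → Ω, Y 0 = X₀ ∧
    (∀ i ∈ Finset.Icc 1 t, ∃ j, Y i j = r i) ∧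
    c = (∑ i ∈ Finset.Icc 1 t, confDist (Y (i - 1)) (Y i)) + confDist (Y t) X }

/-- The offline optimum of the `k`-server instance with initial configuration `X₀`
and requests `r 1, …, r T`. -/
noncomputable def opt {Ω : Type*} [MetricSpace Ω] (k : ℕ) (X₀ : Fin k → Ω)
    (r : ℕ → Ω) (T : ℕ) : ℝ :=
  sInf { c : ℝ | ∃ Y : ℕ → Fin k → Ω, Y 0 = X₀ ∧
    (∀ i ∈ Finset.Icc 1 T, ∃ j, Y i j = r i) ∧
    c = ∑ i ∈ Finset.Icc 1 T, confDist (Y (i - 1)) (Y i) }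

/-- `OPT_t(Z)`: the least cost of serving the first `t` requests while ending
in the configuration `Z`. -/
noncomputable def optTo {Ω : Type*} [MetricSpace Ω] (k : ℕ) (X₀ : Fin k → Ω)
    (r : ℕ → Ω) (t : ℕ) (Z : Fin k → Ω) : ℝ :=
  sInf { c : ℝ | ∃ Y : ℕ → Fin k → Ω, Y 0 = X₀ ∧
    (∀ i ∈ Finset.Icc 1 t, ∃ j, Y i j = r i) ∧ Y t = Z ∧
    c = ∑ i ∈ Finset.Icc 1 t, confDist (Y (i - 1)) (Y i) }

/-- `X 0, X 1, …, X T` is a run of the work function algorithm on the `k`-server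
instance with initial configuration `X₀` and requests `r 1, …, r T`. -/
def IsWFARun {Ω : Type*} [MetricSpace Ω] (k : ℕ) (X₀ : Fin k → Ω)
    (r : ℕ → Ω) (T : ℕ) (X : ℕ → Fin k → Ω) : Prop :=
  X 0 = X₀ ∧ ∀ t, 1 ≤ t → t ≤ T →
    (∃ j, X t j = r t) ∧
    ∀ Z : Fin k → Ω, (∃ j, Z j = r t) →
      optTo k X₀ r t (X t) + confDist (X t) (X (t - 1)) ≤
        optTo k X₀ r t Z + confDist Z (X (t - 1))
/-- The antipode `x̄ = x + Δ` of a point on the circle of circumference `2Δ`. -/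
noncomputable def antip (Δ : ℝ) (x : AddCircle (2*Δ)) : AddCircle (2*Δ) := x + (Δ : ℝ)

/-- The set `P`: triples of circle points not contained in any open semicircle,
i.e. with `d(x,y) + d(y,z) + d(z,x) = 2Δ`. -/
def InP (Δ : ℝ) (x y z : AddCircle (2*Δ)) : Prop :=
  dist x y + dist y z + dist z x = 2*Δ

/-- The potential `Φ*(w,u,x,y,z) = w(ū³) + w(u x ȳ) + w(u y z̄) + w(u z x̄)`. -/
noncomputable def PhiStar (Δ : ℝ) (w : (Fin 3 → AddCircle (2*Δ)) → ℝ)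
    (u x y z : AddCircle (2*Δ)) : ℝ :=
  w ![antip Δ u, antip Δ u, antip Δ u] + w ![u, x, antip Δ y]
    + w ![u, y, antip Δ z] + w ![u, z, antip Δ x]

/-- `w(X)` resolves from the `i`-th point of the configuration `X` (w.r.t. the
last request `r`): `w(X) = w(X - X i + r) + d(X i, r)`. -/
def ResolvesFrom {Ω : Type*} [MetricSpace Ω] (w : (Fin 3 → Ω) → ℝ) (r : Ω)
    (X : Fin 3 → Ω) (i : Fin 3) : Prop :=
  w X = w (Function.update X i r) + dist (X i) r

section ConfDist

variable {Ω : Type*} [MetricSpace Ω] {k : ℕ}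

theorem confDist_le (X Y : Fin k → Ω) (σ : Equiv.Perm (Fin k)) :
    confDist X Y ≤ ∑ i, dist (X i) (Y (σ i)) :=
  ciInf_le (Set.finite_range _).bddBelow σ

theorem exists_confDist_eq (X Y : Fin k → Ω) :
    ∃ σ : Equiv.Perm (Fin k), confDist X Y = ∑ i, dist (X i) (Y (σ i)) := by
  obtain ⟨σ, hσ⟩ := exists_eq_ciInf_of_finite
    (f := fun σ : Equiv.Perm (Fin k) => ∑ i, dist (X i) (Y (σ i)))
  exact ⟨σ, hσ.symm⟩

theorem confDist_nonneg (X Y : Fin k → Ω) : 0 ≤ confDist X Y := by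
  obtain ⟨σ, hσ⟩ := exists_confDist_eq X Y
  rw [hσ]
  positivity

theorem confDist_triangle (X Y Z : Fin k → Ω) :
    confDist X Z ≤ confDist X Y + confDist Y Z := by
  obtain ⟨σ, hσ⟩ := exists_confDist_eq X Y
  obtain ⟨τ, hτ⟩ := exists_confDist_eq Y Z
  rw [hσ, hτ, ← Equiv.sum_comp σ (fun i => dist (Y i) (Z (τ i))), ← Finset.sum_add_distrib]
  exact (confDist_le X Z (σ.trans τ)).trans
    (Finset.sum_le_sum fun i _ => dist_triangle _ _ _)

theorem confDist_comp_right_le (X Y : Fin k → Ω) (π : Equiv.Perm (Fin k)) :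
    confDist X (Y ∘ π) ≤ confDist X Y := by
  obtain ⟨σ, hσ⟩ := exists_confDist_eq X Y
  rw [hσ]
  simpa using confDist_le X (Y ∘ π) (σ.trans π.symm)

theorem confDist_comp_right (X Y : Fin k → Ω) (π : Equiv.Perm (Fin k)) :
    confDist X (Y ∘ π) = confDist X Y := by
  refine (confDist_comp_right_le X Y π).antisymm ?_
  simpa [Function.comp_assoc] using confDist_comp_right_le X (Y ∘ π) π.symm

theorem confDist_comm (X Y : Fin k → Ω) : confDist X Y = confDist Y X := by
  suffices h : ∀ X Y : Fin k → Ω, confDist X Y ≤ confDist Y X from (h X Y).antisymm (h Y X)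
  intro X Y
  obtain ⟨σ, hσ⟩ := exists_confDist_eq Y X
  rw [hσ]
  refine (confDist_le X Y σ.symm).trans_eq ?_
  rw [← Equiv.sum_comp σ]
  simp [dist_comm]

theorem confDist_comp_left (X Y : Fin k → Ω) (π : Equiv.Perm (Fin k)) :
    confDist (X ∘ π) Y = confDist X Y := by
  rw [confDist_comm, confDist_comp_right, confDist_comm]

/-- Optimal matchings `A → X` and `B → Y` induce a bijection between `X` and `Y` along which
points can be exchanged without increasing the total distance. -/
theorem exists_perm_confDist_piecewise_le (A B X Y : Fin k → Ω) :
    ∃ π : Equiv.Perm (Fin k), ∀ T : Finset (Fin k), ∃ T' : Finset (Fin k),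
      confDist (T'.piecewise A B) (T.piecewise X (Y ∘ π)) +
        confDist (T'.piecewise B A) (T.piecewise (Y ∘ π) X) ≤
          confDist A X + confDist B Y := by
  obtain ⟨σ, hσ⟩ := exists_confDist_eq A X
  obtain ⟨τ, hτ⟩ := exists_confDist_eq B Y
  refine ⟨σ.symm.trans τ, fun T => ⟨T.map σ.symm.toEmbedding, ?_⟩⟩
  refine (add_le_add (confDist_le _ _ σ) (confDist_le _ _ σ)).trans ?_
  rw [hσ, hτ, ← Finset.sum_add_distrib, ← Finset.sum_add_distrib]
  refine Finset.sum_le_sum fun i _ => ?_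
  by_cases h : σ i ∈ T
  · simp [Finset.piecewise, h]
  · simp [Finset.piecewise, h, add_comm]

end ConfDist

section WorkFunction

variable {Ω : Type*} [MetricSpace Ω] {k : ℕ} {X₀ : Fin k → Ω} {r : ℕ → Ω} {t : ℕ}

/-- The costs of the schedules that serve the first `t` requests and then move to `X`. -/
def costSet (X₀ : Fin k → Ω) (r : ℕ → Ω) (t : ℕ) (X : Fin k → Ω) : Set ℝ :=
  { c : ℝ | ∃ Y : ℕ → Fin k → Ω, Y 0 = X₀ ∧
    (∀ i ∈ Finset.Icc 1 t, ∃ j, Y i j = r i) ∧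
    c = (∑ i ∈ Finset.Icc 1 t, confDist (Y (i - 1)) (Y i)) + confDist (Y t) X }

theorem workFn_eq_sInf_costSet (X : Fin k → Ω) :
    workFn k X₀ r t X = sInf (costSet X₀ r t X) := rfl

theorem mem_costSet_zero {X : Fin k → Ω} {c : ℝ} :
    c ∈ costSet X₀ r 0 X ↔ c = confDist X₀ X := by
  constructor
  · rintro ⟨Y, rfl, -, rfl⟩
    simp
  · rintro rfl
    exact ⟨fun _ => X₀, rfl, by simp, by simp⟩

theorem mem_costSet_succ {X : Fin k → Ω} {c : ℝ} :
    c ∈ costSet X₀ r (t + 1) X ↔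
      ∃ A : Fin k → Ω, (∃ j, A j = r (t + 1)) ∧
        ∃ c' ∈ costSet X₀ r t A, c = c' + confDist A X := by
  constructor
  · rintro ⟨Y, hY0, hY, rfl⟩
    refine ⟨Y (t + 1), hY _ (by simp), _, ⟨Y, hY0, fun i hi => hY i ?_, rfl⟩, ?_⟩
    · simp only [Finset.mem_Icc] at hi ⊢
      lia
    · rw [Finset.sum_Icc_succ_top (by lia)]
      simp
  · rintro ⟨A, hA, -, ⟨Y, hY0, hY, rfl⟩, rfl⟩
    have hne : ∀ i ≤ t, Function.update Y (t + 1) A i = Y i := fun i hi =>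
      Function.update_of_ne (by lia) _ _
    refine ⟨Function.update Y (t + 1) A, ?_, fun i hi => ?_, ?_⟩
    · rw [hne 0 (by lia), hY0]
    · rw [Finset.mem_Icc] at hi
      rcases hi.2.eq_or_lt with rfl | h
      · simpa using hA
      · rw [hne i (by lia)]
        exact hY i (Finset.mem_Icc.2 ⟨hi.1, by lia⟩)
    · rw [Finset.sum_Icc_succ_top (by lia)]
      simp only [Function.update_self, Nat.add_sub_cancel, hne t le_rfl]
      congr 2
      refine Finset.sum_congr rfl fun i hi => ?_
      rw [Finset.mem_Icc] at hi
      rw [hne i hi.2, hne (i - 1) (by lia)]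

theorem costSet_comp (X : Fin k → Ω) (π : Equiv.Perm (Fin k)) :
    costSet X₀ r t (X ∘ π) = costSet X₀ r t X := by
  simp only [costSet, confDist_comp_right]

theorem costSet_bddBelow (X : Fin k → Ω) : BddBelow (costSet X₀ r t X) := by
  refine ⟨0, ?_⟩
  rintro - ⟨Y, -, -, rfl⟩
  exact add_nonneg (Finset.sum_nonneg fun i _ => confDist_nonneg _ _) (confDist_nonneg _ _)

theorem costSet_nonempty [NeZero k] (X : Fin k → Ω) : (costSet X₀ r t X).Nonempty := by
  induction t generalizing X with
  | zero => exact ⟨_, mem_costSet_zero.2 rfl⟩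
  | succ t ih =>
    obtain ⟨c, hc⟩ := ih fun _ => r (t + 1)
    exact ⟨_, mem_costSet_succ.2 ⟨_, ⟨0, rfl⟩, c, hc, rfl⟩⟩

/-- A family of exchanges between two configurations sharing a point can be modified so that
the shared point is matched to itself. -/
theorem exists_perm_piecewise_fixing {p : Ω} {X Y : Fin k → Ω} {a : ℝ} {j l : Fin k}
    (hX : X j = p) (hY : Y l = p) (π : Equiv.Perm (Fin k))
    (h : ∀ T : Finset (Fin k), ∃ c ∈ costSet X₀ r t (T.piecewise X (Y ∘ π)),
      ∃ d ∈ costSet X₀ r t (T.piecewise (Y ∘ π) X), c + d ≤ a) :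
    ∃ ρ : Equiv.Perm (Fin k), Y (ρ j) = p ∧
      ∀ T : Finset (Fin k), ∃ c ∈ costSet X₀ r t (T.piecewise X (Y ∘ ρ)),
        ∃ d ∈ costSet X₀ r t (T.piecewise (Y ∘ ρ) X), c + d ≤ a := by
  set m := π.symm l with hm
  have hl : π m = l := by simp [hm]
  refine ⟨(Equiv.swap j m).trans π, by simp [hl, hY], fun T => ?_⟩
  by_cases hT : m ∈ T
  · obtain ⟨c, hc, d, hd, hcd⟩ := h (insert j T)
    rw [← costSet_comp _ (Equiv.swap j m)] at hd
    refine ⟨c, ?_, d, ?_, hcd⟩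
    · convert hc using 2
      ext i
      simp [Finset.piecewise, Equiv.swap_apply_def]
      grind
    · convert hd using 2
      ext i
      simp [Finset.piecewise, Equiv.swap_apply_def]
      grind
  · obtain ⟨c, hc, d, hd, hcd⟩ := h (T.erase j)
    rw [← costSet_comp _ (Equiv.swap j m)] at hc
    refine ⟨c, ?_, d, ?_, hcd⟩
    · convert hc using 2
      ext i
      simp [Finset.piecewise, Equiv.swap_apply_def]
      grind
    · convert hd using 2
      ext i
      simp [Finset.piecewise, Equiv.swap_apply_def]
      grind

/-- Quasi-convexity of work functions, at the level of schedules. -/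
theorem exists_perm_costSet_piecewise {X Y : Fin k → Ω} {c d : ℝ}
    (hc : c ∈ costSet X₀ r t X) (hd : d ∈ costSet X₀ r t Y) :
    ∃ π : Equiv.Perm (Fin k), ∀ T : Finset (Fin k),
      ∃ c' ∈ costSet X₀ r t (T.piecewise X (Y ∘ π)),
        ∃ d' ∈ costSet X₀ r t (T.piecewise (Y ∘ π) X), c' + d' ≤ c + d := by
  induction t generalizing X Y c d with
  | zero =>
    rw [mem_costSet_zero] at hc hd
    subst hc hd
    obtain ⟨π, hπ⟩ := exists_perm_confDist_piecewise_le X₀ X₀ X Y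
    refine ⟨π, fun T => ⟨_, mem_costSet_zero.2 rfl, _, mem_costSet_zero.2 rfl, ?_⟩⟩
    obtain ⟨T', hT'⟩ := hπ T
    rwa [show T'.piecewise X₀ X₀ = X₀ by ext i; simp [Finset.piecewise]] at hT'
  | succ t ih =>
    obtain ⟨A, ⟨j, hj⟩, c₁, hc₁, rfl⟩ := mem_costSet_succ.1 hc
    obtain ⟨B, ⟨l, hl⟩, d₁, hd₁, rfl⟩ := mem_costSet_succ.1 hd
    obtain ⟨π, hπ⟩ := ih hc₁ hd₁
    obtain ⟨ρ, hρj, hρ⟩ := exists_perm_piecewise_fixing hj hl π hπ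
    obtain ⟨σ, hσ⟩ := exists_perm_confDist_piecewise_le A (B ∘ ρ) X Y
    refine ⟨σ, fun T => ?_⟩
    obtain ⟨T', hT'⟩ := hσ T
    obtain ⟨c', hc', d', hd', hcd⟩ := hρ T'
    rw [confDist_comp_left] at hT'
    refine ⟨_, mem_costSet_succ.2 ⟨_, ⟨j, ?_⟩, c', hc', rfl⟩,
      _, mem_costSet_succ.2 ⟨_, ⟨j, ?_⟩, d', hd', rfl⟩, by linarith⟩
    · by_cases h : j ∈ T' <;> simp [Finset.piecewise, h, hj, hρj]
    · by_cases h : j ∈ T' <;> simp [Finset.piecewise, h, hj, hρj]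

theorem workFn_le_of_mem {X : Fin k → Ω} {c : ℝ} (hc : c ∈ costSet X₀ r t X) :
    workFn k X₀ r t X ≤ c :=
  csInf_le (costSet_bddBelow X) hc

theorem workFn_comp (X : Fin k → Ω) (π : Equiv.Perm (Fin k)) :
    workFn k X₀ r t (X ∘ π) = workFn k X₀ r t X := by
  rw [workFn_eq_sInf_costSet, costSet_comp, ← workFn_eq_sInf_costSet]

theorem workFn_le_add_confDist [NeZero k] (X Y : Fin k → Ω) :
    workFn k X₀ r t X ≤ workFn k X₀ r t Y + confDist Y X := by
  rw [← sub_le_iff_le_add]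
  refine le_csInf (costSet_nonempty Y) ?_
  rintro - ⟨Z, hZ0, hZ, rfl⟩
  have := workFn_le_of_mem (X := X) ⟨Z, hZ0, hZ, rfl⟩
  linarith [confDist_triangle (Z t) Y X]

/-- Quasi-convexity of work functions. -/
theorem exists_perm_workFn_piecewise_le [NeZero k] (X Y : Fin k → Ω) :
    ∃ π : Equiv.Perm (Fin k), ∀ T : Finset (Fin k),
      workFn k X₀ r t (T.piecewise X (Y ∘ π)) + workFn k X₀ r t (T.piecewise (Y ∘ π) X) ≤
        workFn k X₀ r t X + workFn k X₀ r t Y := by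
  by_contra! h
  choose T hT using h
  obtain ⟨π₀, hπ₀⟩ := Finite.exists_min fun π : Equiv.Perm (Fin k) =>
    workFn k X₀ r t ((T π).piecewise X (Y ∘ π)) + workFn k X₀ r t ((T π).piecewise (Y ∘ π) X)
  set m := workFn k X₀ r t ((T π₀).piecewise X (Y ∘ π₀)) +
    workFn k X₀ r t ((T π₀).piecewise (Y ∘ π₀) X)
  have hgap := hT π₀
  obtain ⟨c, hc, hcm⟩ := exists_lt_of_csInf_lt (costSet_nonempty X)
    (show sInf (costSet X₀ r t X) < m - workFn k X₀ r t Y by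
      rw [← workFn_eq_sInf_costSet]; linarith)
  obtain ⟨d, hd, hdm⟩ := exists_lt_of_csInf_lt (costSet_nonempty Y)
    (show sInf (costSet X₀ r t Y) < m - c by
      rw [← workFn_eq_sInf_costSet]; linarith)
  obtain ⟨π, hπ⟩ := exists_perm_costSet_piecewise hc hd
  obtain ⟨c', hc', d', hd', hcd⟩ := hπ (T π)
  linarith [hπ₀ π, workFn_le_of_mem hc', workFn_le_of_mem hd']

end WorkFunction

section ThreeServers

variable {Ω : Type*} [MetricSpace Ω] {X₀ : Fin 3 → Ω} {r : ℕ → Ω} {t : ℕ}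

theorem workFn_swap_left (a b c : Ω) :
    workFn 3 X₀ r t ![b, a, c] = workFn 3 X₀ r t ![a, b, c] := by
  rw [← workFn_comp ![a, b, c] (Equiv.swap 0 1)]
  congr 1
  ext i
  fin_cases i <;> rfl

theorem workFn_swap_right (a b c : Ω) :
    workFn 3 X₀ r t ![a, c, b] = workFn 3 X₀ r t ![a, b, c] := by
  rw [← workFn_comp ![a, b, c] (Equiv.swap 1 2)]
  congr 1
  ext i
  fin_cases i <;> rfl

theorem workFn_le_add_dist (a b c a' b' c' : Ω) :
    workFn 3 X₀ r t ![a', b', c'] ≤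
      workFn 3 X₀ r t ![a, b, c] + (dist a a' + dist b b' + dist c c') := by
  have h := workFn_le_add_confDist (X₀ := X₀) (r := r) (t := t) ![a', b', c'] ![a, b, c]
  have h' := confDist_le ![a, b, c] ![a', b', c'] 1
  simp only [Fin.sum_univ_three, Equiv.Perm.one_apply, Matrix.cons_val] at h'
  linarith

/-- At a configuration with all servers at `p`, the work function resolves from `p`. -/
theorem workFn_resolve_const (ht : 1 ≤ t) (p : Ω) :
    workFn 3 X₀ r t ![r t, p, p] + dist p (r t) ≤ workFn 3 X₀ r t ![p, p, p] := by
  obtain ⟨n, rfl⟩ : ∃ n, t = n + 1 := ⟨t - 1, by lia⟩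
  refine le_csInf (costSet_nonempty ![p, p, p]) fun c hc => ?_
  obtain ⟨A, ⟨j, hj⟩, c', hc', rfl⟩ := mem_costSet_succ.1 hc
  obtain ⟨σ, hσ⟩ := exists_confDist_eq A ![p, p, p]
  have hconst : ∀ i : Fin 3, ![p, p, p] i = p := fun i => by fin_cases i <;> rfl
  simp only [hconst] at hσ
  have hle := workFn_le_of_mem (X := ![r (n + 1), p, p])
    (mem_costSet_succ.2 ⟨A, ⟨j, hj⟩, c', hc', rfl⟩)
  have h := confDist_le A ![r (n + 1), p, p] (Equiv.swap 0 j)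
  rw [Fin.sum_univ_three] at h hσ
  have hd := dist_comm p (r (n + 1))
  fin_cases j <;> simp [Equiv.swap_apply_def] at h hj <;> simp [hj] at h hσ <;> linarith

/-- The exchange property for configurations sharing a point. -/
theorem workFn_exchange (p a b c d : Ω) :
    workFn 3 X₀ r t ![p, a, c] + workFn 3 X₀ r t ![p, b, d] ≤
        workFn 3 X₀ r t ![p, a, b] + workFn 3 X₀ r t ![p, c, d] ∨
      workFn 3 X₀ r t ![p, a, d] + workFn 3 X₀ r t ![p, b, c] ≤
        workFn 3 X₀ r t ![p, a, b] + workFn 3 X₀ r t ![p, c, d] := by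
  obtain ⟨π, hπ⟩ := exists_perm_workFn_piecewise_le (X₀ := X₀) (r := r) (t := t)
    ![p, a, b] ![p, c, d]
  have key : ∀ T : Finset (Fin 3), ∀ Z Z' : Fin 3 → Ω,
      (∀ i, Z i = if i ∈ T then ![p, a, b] i else ![p, c, d] (π i)) →
      (∀ i, Z' i = if i ∈ T then ![p, c, d] (π i) else ![p, a, b] i) →
      workFn 3 X₀ r t Z + workFn 3 X₀ r t Z' ≤
        workFn 3 X₀ r t ![p, a, b] + workFn 3 X₀ r t ![p, c, d] := by
    intro T Z Z' hZ hZ'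
    obtain rfl : Z = T.piecewise ![p, a, b] (![p, c, d] ∘ π) := funext hZ
    obtain rfl : Z' = T.piecewise (![p, c, d] ∘ π) ![p, a, b] := funext hZ'
    exact hπ T
  have h₁ := key {1} ![![p, c, d] (π 0), a, ![p, c, d] (π 2)] ![p, ![p, c, d] (π 1), b]
    (by intro i; fin_cases i <;> simp) (by intro i; fin_cases i <;> simp)
  have h₂ := key {2} ![![p, c, d] (π 0), ![p, c, d] (π 1), b] ![p, a, ![p, c, d] (π 2)]
    (by intro i; fin_cases i <;> simp) (by intro i; fin_cases i <;> simp)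
  have h01 : π 0 ≠ π 1 := π.injective.ne (by decide)
  have h02 : π 0 ≠ π 2 := π.injective.ne (by decide)
  have h12 : π 1 ≠ π 2 := π.injective.ne (by decide)
  have hl := workFn_swap_left (X₀ := X₀) (r := r) (t := t)
  have hr := workFn_swap_right (X₀ := X₀) (r := r) (t := t)
  generalize π 0 = i at *
  generalize π 1 = j at *
  generalize π 2 = m at *
  fin_cases i <;> fin_cases j <;> fin_cases m <;> simp at h01 h02 h12 h₁ h₂
  · exact .inr (by linarith [hr p b c])
  · exact .inl (by linarith [hr p b d])
  · exact .inr (by linarith [hl p c b, hr p b c])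
  · exact .inl (by linarith [hr c p a, hl p c a, hr p a c, hr p b d])
  · exact .inl (by linarith [hl p d b, hr p b d])
  · exact .inr (by linarith [hr d p a, hl p d a, hr p a d, hr p b c])

theorem workFn_exchange_self (p a b c : Ω) :
    workFn 3 X₀ r t ![p, a, b] + workFn 3 X₀ r t ![p, a, c] ≤
      workFn 3 X₀ r t ![p, a, a] + workFn 3 X₀ r t ![p, b, c] := by
  rcases workFn_exchange (X₀ := X₀) (r := r) (t := t) p a a b c with h | h <;> linarith

end ThreeServers

section Circle

variable {Δ : ℝ}

theorem norm_coe_of_abs_le (hΔ : 0 < Δ) {s : ℝ} (hs : |s| ≤ Δ) :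
    ‖(s : AddCircle (2 * Δ))‖ = |s| := by
  rw [AddCircle.norm_coe_eq_abs_iff (2 * Δ) (by positivity),
    abs_of_pos (show 0 < 2 * Δ by positivity)]
  linarith

theorem exists_coe_eq_of_abs_le (hΔ : 0 < Δ) (a : AddCircle (2 * Δ)) :
    ∃ s : ℝ, |s| ≤ Δ ∧ (s : AddCircle (2 * Δ)) = a := by
  have hle := AddCircle.norm_le_half_period (2 * Δ) (x := a) (by positivity)
  rw [abs_of_pos (by positivity)] at hle
  induction a using QuotientAddGroup.induction_on with
  | H s =>
    rw [AddCircle.norm_eq] at hle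
    refine ⟨_, hle.trans_eq (by ring), ?_⟩
    rw [AddCircle.coe_sub, sub_eq_self, AddCircle.coe_eq_zero_iff]
    exact ⟨_, zsmul_eq_mul _ _⟩

theorem coe_add_two_mul (s : ℝ) : ((s + 2 * Δ : ℝ) : AddCircle (2 * Δ)) = s :=
  AddCircle.coe_add_period _ _

theorem antip_antip (x : AddCircle (2 * Δ)) : antip Δ (antip Δ x) = x := by
  rw [antip, antip, add_assoc, ← AddCircle.coe_add, ← two_mul, AddCircle.coe_period, add_zero]

theorem norm_add_half_period (hΔ : 0 < Δ) (a : AddCircle (2 * Δ)) :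
    ‖a + (Δ : ℝ)‖ = Δ - ‖a‖ := by
  obtain ⟨s, hs, rfl⟩ := exists_coe_eq_of_abs_le hΔ a
  rw [norm_coe_of_abs_le hΔ hs, ← AddCircle.coe_add]
  have hs' := abs_le.1 hs
  rcases le_total s 0 with h | h
  · rw [norm_coe_of_abs_le hΔ (abs_le.2 ⟨by linarith, by linarith⟩),
      abs_of_nonneg (by linarith), abs_of_nonpos h]
    ring
  · rw [show s + Δ = s - Δ + 2 * Δ by ring, coe_add_two_mul,
      norm_coe_of_abs_le hΔ (abs_le.2 ⟨by linarith, by linarith⟩),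
      abs_of_nonpos (by linarith), abs_of_nonneg h]
    ring

theorem dist_antip_left (hΔ : 0 < Δ) (x y : AddCircle (2 * Δ)) :
    dist (antip Δ x) y = Δ - dist x y := by
  rw [dist_eq_norm, dist_eq_norm, antip, add_sub_right_comm, norm_add_half_period hΔ]

theorem dist_antip_right (hΔ : 0 < Δ) (x y : AddCircle (2 * Δ)) :
    dist x (antip Δ y) = Δ - dist x y := by
  rw [dist_comm, dist_antip_left hΔ, dist_comm]

theorem norm_add_cases_of_circle (hΔ : 0 < Δ) (a b : AddCircle (2 * Δ)) :
    ‖a‖ + ‖b‖ + ‖a + b‖ = 2 * Δ ∨ ‖a + b‖ = ‖a‖ + ‖b‖ ∨ ‖a‖ = ‖b‖ + ‖a + b‖ ∨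
      ‖b‖ = ‖a‖ + ‖a + b‖ := by
  obtain ⟨s, hs, rfl⟩ := exists_coe_eq_of_abs_le hΔ a
  obtain ⟨q, hq, rfl⟩ := exists_coe_eq_of_abs_le hΔ b
  rw [norm_coe_of_abs_le hΔ hs, norm_coe_of_abs_le hΔ hq, ← AddCircle.coe_add]
  by_cases h : |s + q| ≤ Δ
  · rw [norm_coe_of_abs_le hΔ h]
    right
    grind
  · have h' : ‖((s + q : ℝ) : AddCircle (2 * Δ))‖ = 2 * Δ - |s + q| := by
      rcases le_total 0 (s + q) with h0 | h0
      · rw [show s + q = s + q - 2 * Δ + 2 * Δ by ring, coe_add_two_mul,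
          norm_coe_of_abs_le hΔ (by grind)]
        grind
      · rw [← coe_add_two_mul, norm_coe_of_abs_le hΔ (by grind)]
        grind
    rw [h']
    left
    grind

/-- Three points of the circle either lie in `P` or one of them lies between the other two. -/
theorem inP_or_dist_eq_add (hΔ : 0 < Δ) (u x y : AddCircle (2 * Δ)) :
    InP Δ u x y ∨ dist x y = dist u x + dist u y ∨ dist u x = dist x y + dist u y ∨
      dist u y = dist u x + dist x y := by
  have h := norm_add_cases_of_circle hΔ (u - x) (x - y)
  rw [sub_add_sub_cancel] at h
  simp only [← dist_eq_norm] at h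
  rw [InP, dist_comm y u]
  tauto

end Circle

/-- Subcase 1b: if `w(u x ȳ)` resolves from `u`, `w(u y z̄)` resolves from `z̄`, and
`w(u z x̄)` resolves from `z`, then there is `(x',y',z') ∈ P` with
`Φ*(w,u,x,y,z) ≥ Φ*(w,r,x',y',z')`. -/
theorem phiStar_subcase_1b (Δ : ℝ) (hΔ : 0 < Δ)
    (X₀ : Fin 3 → AddCircle (2*Δ)) (r : ℕ → AddCircle (2*Δ)) (T t : ℕ)
    (ht : 1 ≤ t) (htT : t ≤ T) (u x y z : AddCircle (2*Δ)) (hP : InP Δ x y z)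
    (h1 : ResolvesFrom (workFn 3 X₀ r t) (r t) ![u, x, antip Δ y] 0)
    (h2 : ResolvesFrom (workFn 3 X₀ r t) (r t) ![u, y, antip Δ z] 2)
    (h3 : ResolvesFrom (workFn 3 X₀ r t) (r t) ![u, z, antip Δ x] 1) :
    ∃ x' y' z' : AddCircle (2*Δ), InP Δ x' y' z' ∧
      PhiStar Δ (workFn 3 X₀ r t) (r t) x' y' z' ≤
        PhiStar Δ (workFn 3 X₀ r t) u x y z := by
  have hcomm : ∀ a b, workFn 3 X₀ r t ![r t, a, b] = workFn 3 X₀ r t ![r t, b, a] :=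
    fun a b => workFn_swap_right _ _ _
  have hu := workFn_resolve_const (X₀ := X₀) (r := r) ht (antip Δ u)
  have hr : ∀ p, workFn 3 X₀ r t ![antip Δ (r t), antip Δ (r t), antip Δ (r t)] ≤
      workFn 3 X₀ r t ![r t, p, antip Δ p] + 2 * Δ := by
    intro p
    have h := workFn_le_add_dist (X₀ := X₀) (r := r) (t := t) (r t) p (antip Δ p)
      (antip Δ (r t)) (antip Δ (r t)) (antip Δ (r t))
    simp only [dist_antip_right hΔ, dist_antip_left hΔ, dist_self] at h
    linarith
  have hlower : workFn 3 X₀ r t ![r t, antip Δ u, antip Δ u] +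
      workFn 3 X₀ r t ![r t, x, antip Δ y] + workFn 3 X₀ r t ![r t, u, y] +
      workFn 3 X₀ r t ![r t, u, antip Δ x] + 2 * Δ ≤ PhiStar Δ (workFn 3 X₀ r t) u x y z := by
    have e1 : Function.update ![u, x, antip Δ y] 0 (r t) = ![r t, x, antip Δ y] := by
      ext i; fin_cases i <;> rfl
    have e2 : Function.update ![u, y, antip Δ z] 2 (r t) = ![u, y, r t] := by
      ext i; fin_cases i <;> rfl
    have e3 : Function.update ![u, z, antip Δ x] 1 (r t) = ![u, r t, antip Δ x] := by
      ext i; fin_cases i <;> rfl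
    rw [ResolvesFrom, e1] at h1
    rw [ResolvesFrom, e2] at h2
    rw [ResolvesFrom, e3, workFn_swap_left (r t) u] at h3
    simp only [Matrix.cons_val, dist_antip_left hΔ] at h1 h2 h3 hu
    rw [PhiStar]
    linarith [workFn_swap_right (X₀ := X₀) (r := r) (t := t) u (r t) y,
      workFn_swap_left (X₀ := X₀) (r := r) (t := t) (r t) u y]
  have hexch := workFn_exchange (X₀ := X₀) (r := r) (t := t) (r t)
  have hexch_self := workFn_exchange_self (X₀ := X₀) (r := r) (t := t) (r t)
  suffices h : ∃ x' y' z' : AddCircle (2 * Δ), InP Δ x' y' z' ∧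
      PhiStar Δ (workFn 3 X₀ r t) (r t) x' y' z' ≤
        workFn 3 X₀ r t ![r t, antip Δ u, antip Δ u] + workFn 3 X₀ r t ![r t, x, antip Δ y] +
        workFn 3 X₀ r t ![r t, u, y] + workFn 3 X₀ r t ![r t, u, antip Δ x] + 2 * Δ by
    obtain ⟨x', y', z', hP', hle⟩ := h
    exact ⟨x', y', z', hP', hle.trans hlower⟩
  simp only [PhiStar, InP]
  rcases inP_or_dist_eq_add hΔ u x y with h | h | h
  · refine ⟨antip Δ u, antip Δ y, antip Δ x, ?_, ?_⟩
    · simp only [dist_antip_right hΔ, dist_antip_left hΔ]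
      rw [InP] at h
      linarith [dist_comm x y, dist_comm u x, dist_comm u y]
    · simp only [antip_antip]
      linarith [hexch_self (antip Δ u) u y, hr u, hcomm u (antip Δ u), hcomm (antip Δ y) x,
        hcomm (antip Δ x) u]
  · refine ⟨antip Δ u, x, y, ?_, ?_⟩
    · simp only [dist_antip_right hΔ, dist_antip_left hΔ]
      linarith [dist_comm u y]
    · simp only [antip_antip]
      linarith [hexch_self (antip Δ u) u (antip Δ x), hr u, hcomm u (antip Δ u), hcomm y u]
  rcases hexch u y x (antip Δ y) with hxy | hxy
  · refine ⟨antip Δ u, u, x, ?_, ?_⟩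
    · simp only [dist_antip_right hΔ, dist_antip_left hΔ, dist_self]
      linarith [dist_comm u x]
    · simp only [antip_antip]
      linarith [hr y, hcomm x u]
  rcases h with h | h
  · refine ⟨antip Δ u, y, antip Δ x, ?_, ?_⟩
    · simp only [dist_antip_right hΔ, dist_antip_left hΔ]
      linarith [dist_comm x y, dist_comm u x]
    · simp only [antip_antip]
      linarith [hexch_self (antip Δ u) u (antip Δ y), hr u, hcomm u (antip Δ u),
        hcomm (antip Δ x) u]
  · refine ⟨antip Δ u, x, antip Δ y, ?_, ?_⟩
    · simp only [dist_antip_right hΔ, dist_antip_left hΔ]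
      linarith [dist_comm u y]
    · simp only [antip_antip]
      linarith [hexch_self (antip Δ u) u (antip Δ x), hr u, hcomm u (antip Δ u),
        hcomm (antip Δ y) u, hcomm x y]
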